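/- For |a| ≥ 66 and |λ| = 1, the map f_a(z) = λ·a·(e^{z/a}(z+1-a) - 1 + a) satisfies: for every z with |z| = R := 8.12311 (so more simply R = 9 works), |f_a(z) - g(z)| < S where g(z) = λ·z·(z/2 + 1) and S = R²/2 - 2R. Consequently, by Rouché's theorem, for every w with |w| < R the equation f_a(z) = w has exactly two solutions (with multiplicity) in the disc D(0,R). -/

import Mathlib

open Complex Metric

/-- If an entire function, nonzero at some point of the disc of radius `R`, is divisible by linear
factors with roots in that disc, then the number of these factors is bounded. -/
lemma exists_card_bound_of_factorization {F : ℂ → ℂ} (hF : Differentiable ℂ F) {R : ℝ}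
    (hR : 0 < R) {p : ℂ} (hp : p ∈ closedBall (0 : ℂ) R) (hFp : F p ≠ 0) :
    ∃ N : ℕ, ∀ (s : Multiset ℂ) (H : ℂ → ℂ), (∀ x ∈ s, x ∈ ball (0 : ℂ) R) →
      Differentiable ℂ H → (∀ z, F z = (s.map (z - ·)).prod * H z) → s.card ≤ N := by
  obtain ⟨M, hM⟩ := (isCompact_sphere (0 : ℂ) (4 * R)).exists_bound_of_continuousOn
    hF.continuous.continuousOn
  have hlow : ∀ (s : Multiset ℂ), (∀ x ∈ s, x ∈ ball (0 : ℂ) R) → ∀ z : ℂ, ‖z‖ = 4 * R →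
      (3 * R) ^ s.card ≤ ‖(s.map (z - ·)).prod‖ := by
    intro s hs z hz
    induction s using Multiset.induction_on with
    | empty => simp
    | cons x s ih =>
      have hx : ‖x‖ < R := by simpa using hs x (Multiset.mem_cons_self x s)
      have h1 := ih fun y hy => hs y (Multiset.mem_cons_of_mem hy)
      have h2 : 3 * R ≤ ‖z - x‖ := by linarith [norm_sub_norm_le z x]
      simp only [Multiset.card_cons, Multiset.map_cons, Multiset.prod_cons, norm_mul, pow_succ']
      gcongr
  have hupp : ∀ (s : Multiset ℂ), (∀ x ∈ s, x ∈ ball (0 : ℂ) R) →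
      ‖(s.map (p - ·)).prod‖ ≤ (2 * R) ^ s.card := by
    intro s hs
    induction s using Multiset.induction_on with
    | empty => simp
    | cons x s ih =>
      have hx : ‖x‖ < R := by simpa using hs x (Multiset.mem_cons_self x s)
      have hp' : ‖p‖ ≤ R := by simpa using hp
      have h1 := ih fun y hy => hs y (Multiset.mem_cons_of_mem hy)
      have h2 : ‖p - x‖ ≤ 2 * R := by linarith [norm_sub_le p x]
      simp only [Multiset.card_cons, Multiset.map_cons, Multiset.prod_cons, norm_mul, pow_succ']
      gcongr
  have hlim : Filter.Tendsto (fun n : ℕ => (2 / 3 : ℝ) ^ n * M) Filter.atTop (nhds 0) := by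
    simpa using (tendsto_pow_atTop_nhds_zero_of_lt_one (r := (2 / 3 : ℝ))
      (by norm_num) (by norm_num)).mul_const M
  obtain ⟨N, hN⟩ := Filter.eventually_atTop.1
    (hlim.eventually (gt_mem_nhds (norm_pos_iff.2 hFp)))
  refine ⟨N, fun s H hs hH hfac => ?_⟩
  by_contra! hlt
  have hHp : ‖H p‖ ≤ M / (3 * R) ^ s.card := by
    refine norm_le_of_forall_mem_frontier_norm_le (U := ball (0 : ℂ) (4 * R)) isBounded_ball
      hH.diffContOnCl (fun z hz => ?_) (subset_closure ?_)
    · rw [frontier_ball _ (by positivity)] at hz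
      have h1 := hM z hz
      have h2 := hlow s hs z (by simpa using hz)
      rw [hfac z, norm_mul] at h1
      rw [le_div_iff₀ (by positivity)]
      nlinarith [norm_nonneg (H z)]
    · have hp' : ‖p‖ ≤ R := by simpa using hp
      simp only [mem_ball, dist_zero_right]
      linarith
  have h3 : ‖F p‖ ≤ (2 * R) ^ s.card * (M / (3 * R) ^ s.card) := by
    rw [hfac p, norm_mul]
    exact mul_le_mul (hupp s hs) hHp (norm_nonneg _) (by positivity)
  have h4 : (2 * R) ^ s.card * (M / (3 * R) ^ s.card) = (2 / 3 : ℝ) ^ s.card * M := by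
    rw [mul_pow, mul_pow, div_pow]
    field_simp
  have h5 := hN s.card hlt.le
  linarith

/-- An entire function with a nonzero value on a disc factors as a product of linear factors with
roots in the open disc and an entire function without zeros there. -/
lemma exists_factorization_ball {F : ℂ → ℂ} (hF : Differentiable ℂ F) {R : ℝ}
    (hR : 0 < R) {p : ℂ} (hp : p ∈ closedBall (0 : ℂ) R) (hFp : F p ≠ 0) :
    ∃ (s : Multiset ℂ) (H : ℂ → ℂ), (∀ x ∈ s, x ∈ ball (0 : ℂ) R) ∧ Differentiable ℂ H ∧
      (∀ z, F z = (s.map (z - ·)).prod * H z) ∧ ∀ z ∈ ball (0 : ℂ) R, H z ≠ 0 := by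
  obtain ⟨N, hN⟩ := exists_card_bound_of_factorization hF hR hp hFp
  by_contra! hcon
  have key : ∀ n : ℕ, ∃ (s : Multiset ℂ) (H : ℂ → ℂ), s.card = n ∧
      (∀ x ∈ s, x ∈ ball (0 : ℂ) R) ∧ Differentiable ℂ H ∧
      ∀ z, F z = (s.map (z - ·)).prod * H z := by
    intro n
    induction n with
    | zero => exact ⟨0, F, by simp, by simp, hF, by simp⟩
    | succ n ih =>
      obtain ⟨s, H, hcard, hs, hH, hfac⟩ := ih
      obtain ⟨x, hx, hHx⟩ := hcon s H hs hH hfac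
      refine ⟨x ::ₘ s, dslope H x, by simp [hcard], ?_, ?_, fun z => ?_⟩
      · intro y hy
        rcases Multiset.mem_cons.1 hy with rfl | hy
        · exact hx
        · exact hs y hy
      · rw [← differentiableOn_univ] at hH ⊢
        exact (Complex.differentiableOn_dslope Filter.univ_mem).2 hH
      · have h := sub_smul_dslope H x z
        rw [hHx, sub_zero, smul_eq_mul] at h
        rw [hfac z, ← h, Multiset.map_cons, Multiset.prod_cons]
        ring
  obtain ⟨s, H, hcard, hs, hH, hfac⟩ := key (N + 1)
  have := hN s H hs hH hfac
  omega

/-- The logarithmic derivative of an entire function without zeros on a circle is circle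
integrable. -/
lemma circleIntegrable_logDeriv {F : ℂ → ℂ} (hF : Differentiable ℂ F) {R : ℝ} (hR : 0 ≤ R)
    (hne : ∀ z ∈ sphere (0 : ℂ) R, F z ≠ 0) : CircleIntegrable (logDeriv F) 0 R :=
  (ContinuousOn.div hF.deriv.continuous.continuousOn hF.continuous.continuousOn
    hne).circleIntegrable hR

/-- The argument principle for a product of linear factors and a nonvanishing function. -/
lemma circleIntegral_logDeriv_of_factorization {R : ℝ} (hR : 0 < R) {H : ℂ → ℂ}
    (hH : Differentiable ℂ H) (hH0 : ∀ z ∈ ball (0 : ℂ) R, H z ≠ 0) (s : Multiset ℂ)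
    (hs : ∀ x ∈ s, x ∈ ball (0 : ℂ) R) :
    ∀ F : ℂ → ℂ, (∀ z, F z = (s.map (z - ·)).prod * H z) →
      (∀ z ∈ sphere (0 : ℂ) R, F z ≠ 0) →
      Differentiable ℂ F ∧ (∮ z in C(0, R), logDeriv F z) = s.card * (2 * Real.pi * I) := by
  induction s using Multiset.induction_on with
  | empty =>
    intro F hfac hne
    obtain rfl : F = H := funext fun z => by simpa using hfac z
    refine ⟨hH, ?_⟩
    have hne' : ∀ z ∈ closedBall (0 : ℂ) R, F z ≠ 0 := by
      intro z hz
      rw [← ball_union_sphere] at hz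
      exact hz.elim (hH0 z) (hne z)
    simp only [Multiset.card_zero, Nat.cast_zero, zero_mul]
    refine circleIntegral_eq_zero_of_differentiable_on_off_countable hR.le Set.countable_empty
      (ContinuousOn.div hH.deriv.continuous.continuousOn hH.continuous.continuousOn hne') ?_
    intro z hz
    exact (hH.deriv z).div (hH z) (hne' z (ball_subset_closedBall hz.1))
  | cons x s ih =>
    intro F hfac hne
    have hx := hs x (Multiset.mem_cons_self x s)
    have hfac' : ∀ z, F z = (z - x) * ((s.map (z - ·)).prod * H z) := fun z => by
      rw [hfac z, Multiset.map_cons, Multiset.prod_cons, mul_assoc]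
    have hneK : ∀ z ∈ sphere (0 : ℂ) R, (s.map (z - ·)).prod * H z ≠ 0 := fun z hz h =>
      hne z hz (by rw [hfac' z, h, mul_zero])
    have hnex : ∀ z ∈ sphere (0 : ℂ) R, z - x ≠ 0 := fun z hz h =>
      hne z hz (by rw [hfac' z, h, zero_mul])
    obtain ⟨hK, hint⟩ := ih (fun y hy => hs y (Multiset.mem_cons_of_mem hy))
      (fun z => (s.map (z - ·)).prod * H z) (fun _ => rfl) hneK
    set K : ℂ → ℂ := fun z => (s.map (z - ·)).prod * H z with hKdef
    obtain rfl : F = fun z => (z - x) * K z := funext hfac'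
    refine ⟨by fun_prop, ?_⟩
    have hlog : Set.EqOn (logDeriv fun z => (z - x) * K z)
        (fun z => (z - x)⁻¹ + logDeriv K z) (sphere (0 : ℂ) R) := by
      intro z hz
      have h := logDeriv_mul (f := fun z => z - x) (g := K) z (hnex z hz) (hneK z hz)
        (by fun_prop) (hK z)
      rw [h, logDeriv_apply (fun z => z - x)]
      simp
    have hinv : CircleIntegrable (fun z => (z - x)⁻¹) 0 R :=
      (ContinuousOn.inv₀ (by fun_prop) hnex).circleIntegrable hR.le
    rw [circleIntegral.integral_congr hR.le hlog,
      circleIntegral.integral_add hinv (circleIntegrable_logDeriv hK hR.le hneK),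
      circleIntegral.integral_sub_inv_of_mem_ball hx, hint, Multiset.card_cons]
    push_cast
    ring

/-- If `‖F - G‖ < ‖G‖` on a circle, the logarithmic derivatives of `F` and `G` have equal
integrals over it. -/
lemma circleIntegral_logDeriv_eq_of_norm_sub_lt {F G : ℂ → ℂ} (hF : Differentiable ℂ F)
    (hG : Differentiable ℂ G) {R : ℝ} (hR : 0 ≤ R)
    (hFG : ∀ z ∈ sphere (0 : ℂ) R, ‖F z - G z‖ < ‖G z‖) :
    (∮ z in C(0, R), logDeriv F z) = ∮ z in C(0, R), logDeriv G z := by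
  have hG0 : ∀ z ∈ sphere (0 : ℂ) R, G z ≠ 0 := fun z hz =>
    norm_pos_iff.1 ((norm_nonneg _).trans_lt (hFG z hz))
  have hF0 : ∀ z ∈ sphere (0 : ℂ) R, F z ≠ 0 := fun z hz h => by
    simpa [h] using hFG z hz
  rw [← sub_eq_zero, ← circleIntegral.integral_sub (circleIntegrable_logDeriv hF hR hF0)
    (circleIntegrable_logDeriv hG hR hG0)]
  refine circleIntegral.integral_eq_zero_of_hasDerivWithinAt hR
    (f := fun z => Complex.log (F z / G z)) fun z hz => ?_
  have hslit : F z / G z ∈ slitPlane := by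
    have h : ‖F z / G z - 1‖ < 1 := by
      rw [div_sub_one (hG0 z hz), norm_div, div_lt_one (norm_pos_iff.2 (hG0 z hz))]
      exact hFG z hz
    exact ball_one_subset_slitPlane (by simpa [dist_eq_norm] using h)
  have hd := (((hF z).hasDerivAt.div (hG z).hasDerivAt (hG0 z hz)).clog hslit).hasDerivWithinAt
    (s := sphere (0 : ℂ) R)
  refine hd.congr_deriv ?_
  have h1 := hG0 z hz
  have h2 := hF0 z hz
  simp only [logDeriv_apply, Pi.div_apply]
  field_simp

/-- **Rouché's theorem** for entire functions, in factorized form. -/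
theorem exists_factorization_of_norm_sub_lt {F G K : ℂ → ℂ} (hF : Differentiable ℂ F) {R : ℝ}
    (hR : 0 < R) (hK : Differentiable ℂ K) (hK0 : ∀ z ∈ ball (0 : ℂ) R, K z ≠ 0)
    {t : Multiset ℂ} (ht : ∀ x ∈ t, x ∈ ball (0 : ℂ) R)
    (hG : ∀ z, G z = (t.map (z - ·)).prod * K z)
    (hFG : ∀ z ∈ sphere (0 : ℂ) R, ‖F z - G z‖ < ‖G z‖) :
    ∃ (s : Multiset ℂ) (H : ℂ → ℂ), s.card = t.card ∧ (∀ x ∈ s, x ∈ ball (0 : ℂ) R) ∧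
      Differentiable ℂ H ∧ (∀ z, F z = (s.map (z - ·)).prod * H z) ∧
      ∀ z ∈ ball (0 : ℂ) R, H z ≠ 0 := by
  have hG0 : ∀ z ∈ sphere (0 : ℂ) R, G z ≠ 0 := fun z hz =>
    norm_pos_iff.1 ((norm_nonneg _).trans_lt (hFG z hz))
  have hF0 : ∀ z ∈ sphere (0 : ℂ) R, F z ≠ 0 := fun z hz h => by
    simpa [h] using hFG z hz
  have hR' : (R : ℂ) ∈ sphere (0 : ℂ) R := by simp [abs_of_pos hR]
  obtain ⟨s, H, hs, hH, hfac, hH0⟩ :=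
    exists_factorization_ball hF hR (sphere_subset_closedBall hR') (hF0 _ hR')
  obtain ⟨-, hFint⟩ := circleIntegral_logDeriv_of_factorization hR hH hH0 s hs F hfac hF0
  obtain ⟨hGd, hGint⟩ := circleIntegral_logDeriv_of_factorization hR hK hK0 t ht G hG hG0
  refine ⟨s, H, ?_, hs, hH, hfac, hH0⟩
  have h := circleIntegral_logDeriv_eq_of_norm_sub_lt hF hGd hR.le hFG
  rw [hFint, hGint] at h
  exact_mod_cast mul_right_cancel₀ two_pi_I_ne_zero h

/-- Distance of the exponential family to its limiting quadratic polynomial on the circle. -/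
lemma norm_exp_family_sub_quadratic_lt {a lam z : ℂ} (hlam : ‖lam‖ = 1) (ha : 66 ≤ ‖a‖)
    (hz : ‖z‖ = (8.12311 : ℝ)) :
    ‖lam * a * (Complex.exp (z / a) * (z + 1 - a) - 1 + a) - lam * z * (z / 2 + 1)‖
      < (8.12311 : ℝ) ^ 2 / 2 - 2 * 8.12311 := by
  have ha0 : a ≠ 0 := norm_pos_iff.1 (by linarith)
  set u := z / a with hu
  have hzu : z = a * u := by rw [hu]; field_simp
  have hru : ‖a‖ * ‖u‖ = 8.12311 := by rw [← norm_mul, ← hzu, hz]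
  have hr : ‖u‖ ≤ 1 / 8 := by
    by_contra! h
    nlinarith
  set E := Complex.exp u - (1 + u + u ^ 2 / 2) with hE
  have hEb : ‖E‖ ≤ ‖u‖ ^ 3 * (2 / 9) := by
    have h := Complex.exp_bound (x := u) (by linarith) (n := 3) (by norm_num)
    norm_num [Finset.sum_range_succ, Nat.factorial] at h
    exact h
  have hexp : Complex.exp u = 1 + u + u ^ 2 / 2 + E := by rw [hE]; ring
  have hid : lam * a * (Complex.exp u * (z + 1 - a) - 1 + a) - lam * z * (z / 2 + 1)
      = lam * (z ^ 2 * (u / 2) + a ^ 2 * ((u - 1) * E) + (z * (u / 2) + a * E)) := by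
    rw [hexp, hzu]; ring
  have hu1 : ‖u - 1‖ ≤ 9 / 8 := by
    have := norm_sub_le u 1
    rw [norm_one] at this
    linarith
  have h2 : ‖u / 2‖ ≤ 1 / 16 := by
    rw [norm_div, Complex.norm_ofNat]; linarith
  have haE : ‖a‖ * ‖E‖ ≤ 8.12311 * (‖u‖ ^ 2 * (2 / 9)) := by
    calc ‖a‖ * ‖E‖ ≤ ‖a‖ * (‖u‖ ^ 3 * (2 / 9)) := by gcongr
      _ = ‖a‖ * ‖u‖ * (‖u‖ ^ 2 * (2 / 9)) := by ring
      _ = _ := by rw [hru]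
  have haaE : ‖a‖ ^ 2 * ‖E‖ ≤ 8.12311 ^ 2 * (‖u‖ * (2 / 9)) := by
    calc ‖a‖ ^ 2 * ‖E‖ ≤ ‖a‖ ^ 2 * (‖u‖ ^ 3 * (2 / 9)) := by gcongr
      _ = (‖a‖ * ‖u‖) ^ 2 * (‖u‖ * (2 / 9)) := by ring
      _ = _ := by rw [hru]
  have t1 : ‖z ^ 2 * (u / 2)‖ ≤ 8.12311 ^ 2 * (1 / 16) := by
    rw [norm_mul, norm_pow, hz]; gcongr
  have t2 : ‖a ^ 2 * ((u - 1) * E)‖ ≤ 9 / 8 * (8.12311 ^ 2 * (1 / 8 * (2 / 9))) := by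
    rw [norm_mul, norm_mul, norm_pow]
    calc ‖a‖ ^ 2 * (‖u - 1‖ * ‖E‖) = ‖u - 1‖ * (‖a‖ ^ 2 * ‖E‖) := by ring
      _ ≤ 9 / 8 * (8.12311 ^ 2 * (‖u‖ * (2 / 9))) := by gcongr
      _ ≤ _ := by gcongr
  have t3 : ‖z * (u / 2)‖ ≤ 8.12311 * (1 / 16) := by
    rw [norm_mul, hz]; gcongr
  have t4 : ‖a * E‖ ≤ 8.12311 * ((1 / 8) ^ 2 * (2 / 9)) := by
    rw [norm_mul]
    refine haE.trans ?_
    gcongr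
  rw [hid, norm_mul, hlam, one_mul]
  refine (norm_add_le_of_le (norm_add_le_of_le t1 t2) (norm_add_le_of_le t3 t4)).trans_lt ?_
  norm_num

/-- Outside the disc of radius `R`, the quadratic polynomial `λz(z/2+1)` has norm at least
`R(R/2-1)`. -/
lemma le_norm_quadratic {lam z : ℂ} (hlam : ‖lam‖ = 1) {R : ℝ} (hR : 2 ≤ R) (hz : R ≤ ‖z‖) :
    R * (R / 2 - 1) ≤ ‖lam * z * (z / 2 + 1)‖ := by
  have h : ‖z‖ / 2 - 1 ≤ ‖z / 2 + 1‖ := by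
    have := norm_sub_le_norm_add (z / 2) 1
    rwa [norm_div, Complex.norm_ofNat, norm_one] at this
  rw [norm_mul, norm_mul, hlam, one_mul]
  have h0 : 0 ≤ R / 2 - 1 := by linarith
  have h1 : R / 2 - 1 ≤ ‖z / 2 + 1‖ := by linarith
  gcongr

/-- For `|a| ≥ 66` and `|λ| = 1`, with `R = 8.12311` and `S = R²/2 - 2R`, on the circle
`|z| = R` we have `|f_a(z) - g(z)| < S` where `g(z) = λz(z/2+1)`; consequently (Rouché) for
every `|w| < R` the equation `f_a(z) = w` has exactly two solutions with multiplicity in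
`D(0,R)`: `f_a(z) - w = (z-z₁)(z-z₂)h(z)` with `h` analytic and nonvanishing on `D(0,R)`. -/
theorem polynomial_like_degree_two (a lam : ℂ) (hlam : ‖lam‖ = 1) (ha : 66 ≤ ‖a‖) :
    (∀ z : ℂ, ‖z‖ = (8.12311 : ℝ) →
      ‖lam * a * (Complex.exp (z / a) * (z + 1 - a) - 1 + a) - lam * z * (z / 2 + 1)‖
        < (8.12311 : ℝ) ^ 2 / 2 - 2 * 8.12311) ∧
    (∀ w : ℂ, ‖w‖ < (8.12311 : ℝ) →
      ∃ z₁ ∈ ball (0 : ℂ) 8.12311, ∃ z₂ ∈ ball (0 : ℂ) 8.12311, ∃ h : ℂ → ℂ,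
        AnalyticOn ℂ h (ball (0 : ℂ) 8.12311) ∧
        ∀ z ∈ ball (0 : ℂ) 8.12311, h z ≠ 0 ∧
          lam * a * (Complex.exp (z / a) * (z + 1 - a) - 1 + a) - w
            = (z - z₁) * (z - z₂) * h z) := by
  refine ⟨fun z hz => norm_exp_family_sub_quadratic_lt hlam ha hz, fun w hw => ?_⟩
  have hlam0 : lam ≠ 0 := norm_pos_iff.1 (by rw [hlam]; exact one_pos)
  obtain ⟨c, hc⟩ := IsAlgClosed.exists_pow_nat_eq (1 + 2 * w / lam) (n := 2) two_pos
  have hquad : ∀ z, lam * z * (z / 2 + 1) - w = (z - (c - 1)) * (z - (-c - 1)) * (lam / 2) := by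
    intro z
    have hw' : w = lam * (c ^ 2 - 1) / 2 := by rw [hc]; field_simp; ring
    rw [hw']; ring
  have hroot : ∀ x, lam * x * (x / 2 + 1) - w = 0 → x ∈ ball (0 : ℂ) 8.12311 := by
    intro x hx
    rw [mem_ball_zero_iff]
    by_contra! h
    have h1 := le_norm_quadratic hlam (by norm_num) h
    rw [sub_eq_zero.1 hx] at h1
    norm_num at h1 hw
    linarith
  obtain ⟨s, h, hcard, hs, hh, hfac, hh0⟩ := exists_factorization_of_norm_sub_lt
    (F := fun z => lam * a * (Complex.exp (z / a) * (z + 1 - a) - 1 + a) - w)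
    (G := fun z => lam * z * (z / 2 + 1) - w) (K := fun _ => lam / 2)
    (R := 8.12311) (t := {c - 1, -c - 1}) (by fun_prop) (by norm_num) (by fun_prop)
    (fun _ _ => div_ne_zero hlam0 two_ne_zero)
    (by
      intro x hx
      refine hroot x ?_
      rw [hquad]
      rcases (by simpa using hx : x = c - 1 ∨ x = -c - 1) with rfl | rfl <;> ring)
    (fun z => by simp [hquad])
    (by
      intro z hz
      have hz' : ‖z‖ = (8.12311 : ℝ) := by simpa using hz
      have h1 := le_norm_quadratic hlam (by norm_num) hz'.ge
      have h2 := norm_sub_norm_le (lam * z * (z / 2 + 1)) w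
      rw [sub_sub_sub_cancel_right]
      linarith [norm_exp_family_sub_quadratic_lt hlam ha hz'])
  obtain ⟨z₁, z₂, rfl⟩ := Multiset.card_eq_two.1 (hcard.trans (by simp))
  refine ⟨z₁, hs z₁ (by simp), z₂, hs z₂ (by simp), h,
    fun z _ => (hh.analyticAt z).analyticWithinAt, fun z hz => ⟨hh0 z hz, ?_⟩⟩
  simpa using hfac z
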